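/- Let G be a graph with 2h vertices, none of which is isolated, whose vertices are labeled so that condition (*) holds (V(G) is the disjoint union of the minimal vertex cover X = {x_1,…,x_h} and the maximal independent set Y = {y_1,…,y_h} with x_i y_i ∈ E(G) for all i) and condition (**) holds (x_i y_j ∈ E(G) implies i ≤ j). Then the following are equivalent: (1) G is Cohen-Macaulay; (2) G is unmixed; (3) both of the following hold: (i) if z_i x_j ∈ E(G) and y_j x_k ∈ E(G) for distinct indices i, j, k and z_i ∈ {x_i, y_i}, then z_i x_k ∈ E(G); (ii) if x_i y_j ∈ E(G), then x_i x_j ∉ E(G). -/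

import Mathlib

universe u

/-- An independent set in a graph. -/
def IsIndepSet {V : Type*} (G : SimpleGraph V) (A : Set V) : Prop :=
  A.Pairwise fun u v => ¬ G.Adj u v

/-- A maximal independent set in a graph. -/
def IsMaxIndepSet {V : Type*} (G : SimpleGraph V) (A : Set V) : Prop :=
  IsIndepSet G A ∧ ∀ B, IsIndepSet G B → A ⊆ B → A = B

/-- A vertex cover of a graph. -/
def IsVertexCover {V : Type*} (G : SimpleGraph V) (C : Set V) : Prop :=
  ∀ ⦃u v⦄, G.Adj u v → u ∈ C ∨ v ∈ C

/-- A minimal vertex cover of a graph. -/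
def IsMinVertexCover {V : Type*} (G : SimpleGraph V) (C : Set V) : Prop :=
  IsVertexCover G C ∧ ∀ B ⊆ C, IsVertexCover G B → B = C

/-- A graph has no isolated vertices. -/
def HasNoIsolatedVertices {V : Type*} (G : SimpleGraph V) : Prop :=
  ∀ v, ∃ u, G.Adj v u

/-- A graph is very well-covered if it has no isolated vertices, an even number of
vertices, and every maximal independent set has cardinality half the number of vertices. -/
def IsVeryWellCovered {V : Type*} [Fintype V] (G : SimpleGraph V) : Prop :=
  HasNoIsolatedVertices G ∧ Even (Fintype.card V) ∧
    ∀ A : Set V, IsMaxIndepSet G A → A.ncard = Fintype.card V / 2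

/-- Condition (*) for a graph on the `2h` vertices `x_1, …, x_h, y_1, …, y_h`
(encoded as `Sum.inl 0, …, Sum.inl (h-1), Sum.inr 0, …, Sum.inr (h-1)`):
`X = {x_1, …, x_h}` is a minimal vertex cover, `Y = {y_1, …, y_h}` is a maximal
independent set, and `x_i y_i` is an edge for every `i`. -/
def CondStar {h : ℕ} (G : SimpleGraph (Fin h ⊕ Fin h)) : Prop :=
  IsMinVertexCover G (Set.range Sum.inl) ∧
    IsMaxIndepSet G (Set.range Sum.inr) ∧
    ∀ i : Fin h, G.Adj (Sum.inl i) (Sum.inr i)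

open CategoryTheory in
/-- The Ext module `Ext_R^n(M, N)`. -/
noncomputable def ExtMod (R : Type u) [CommRing R] (n : ℕ) (M N : Type u)
    [AddCommGroup M] [Module R M] [AddCommGroup N] [Module R N] : ModuleCat R :=
  ((Ext R (ModuleCat R) n).obj (Opposite.op (ModuleCat.of R M))).obj (ModuleCat.of R N)

/-- The depth of a local ring `R`, defined via vanishing of the Ext modules
`Ext_R^n(k, R)`, where `k` is the residue field of `R`. -/
noncomputable def localRingDepth (R : Type u) [CommRing R] [IsLocalRing R] : ℕ∞ :=
  sInf {n : ℕ∞ | ∃ m : ℕ, n = m ∧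
    Nontrivial (ExtMod R m (IsLocalRing.ResidueField R) R)}

/-- A commutative ring is Cohen-Macaulay if for every maximal ideal `p`, the depth of the
localization at `p` equals its Krull dimension. -/
def IsCohenMacaulayRing (R : Type u) [CommRing R] : Prop :=
  ∀ (p : Ideal R) [p.IsMaximal],
    (localRingDepth (Localization.AtPrime p) : WithBot ℕ∞) =
      ringKrullDim (Localization.AtPrime p)

/-- The (unweighted) edge ideal `I(G)` of a graph, generated by the monomials `X u * X v`
for the edges `uv` of `G`. -/
noncomputable def edgeIdeal {V : Type*} (K : Type*) [CommSemiring K]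
    (G : SimpleGraph V) : Ideal (MvPolynomial V K) :=
  Ideal.span ((fun e => Sym2.lift ⟨fun u v => MvPolynomial.X u * MvPolynomial.X v,
    fun u v => mul_comm _ _⟩ e) '' G.edgeSet)

/-- A graph is unmixed if all its minimal vertex covers have the same cardinality. -/
def IsUnmixedGraph {V : Type*} (G : SimpleGraph V) : Prop :=
  ∀ C₁ C₂ : Set V, IsMinVertexCover G C₁ → IsMinVertexCover G C₂ → C₁.ncard = C₂.ncard

open CategoryTheory Limits in
/-- The derived-functor `Ext` vanishes exactly when the derived-category `Ext` does. -/
theorem subsingleton_extMod_iff {R : Type u} [CommRing R] (n : ℕ) (M N : Type u)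
    [AddCommGroup M] [Module R M] [AddCommGroup N] [Module R N] :
    Subsingleton (ExtMod R n M N) ↔
      Subsingleton (Abelian.Ext (ModuleCat.of R M) (ModuleCat.of R N) n) := by
  let P : ProjectiveResolution (ModuleCat.of R M) := Classical.choice
    (inferInstance : HasProjectiveResolution (ModuleCat.of R M)).out
  have h : Subsingleton (ExtMod R n M N) ↔
      IsZero ((P.complex.linearYonedaObj R (ModuleCat.of R N)).homology n) := by
    rw [← (P.isoExt (R := R) n (ModuleCat.of R N)).isZero_iff, ModuleCat.isZero_iff_subsingleton]
    rfl
  rw [h, ← HomologicalComplex.exactAt_iff_isZero_homology]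
  cases n with
  | zero =>
    rw [HomologicalComplex.exactAt_iff' _ 0 0 1 (by simp) (by simp),
      ShortComplex.moduleCat_exact_iff, Abelian.Ext.addEquiv₀.subsingleton_congr]
    have hd : (P.complex.linearYonedaObj R (ModuleCat.of R N)).d 0 0 = 0 :=
      HomologicalComplex.shape _ _ _ (by simp)
    constructor
    · intro h
      refine subsingleton_of_forall_eq 0 fun f => ?_
      refine (cancel_epi (P.π.f 0)).1 (Eq.trans ?_ comp_zero.symm)
      obtain ⟨g, hg⟩ := h (P.π.f 0 ≫ f) (P.complex_d_comp_π_f_zero_assoc f |>.trans zero_comp)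
      rw [← hg]
      exact congrArg (fun t => t.hom g) hd
    · intro h f hf
      refine ⟨0, ?_⟩
      rw [map_zero]
      obtain ⟨l, hl⟩ := CokernelCofork.IsColimit.desc' P.isColimitCokernelCofork f hf
      have hl0 : l = 0 := h.elim (l : ModuleCat.of R M ⟶ ModuleCat.of R N) 0
      rw [← hl, hl0, comp_zero]
      rfl
  | succ n =>
    rw [HomologicalComplex.exactAt_iff' _ n (n + 1) (n + 2) (by simp) (by simp),
      ShortComplex.moduleCat_exact_iff]
    constructor
    · intro h
      refine subsingleton_of_forall_eq 0 fun α => ?_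
      obtain ⟨f, hf, rfl⟩ := P.extMk_surjective α (n + 2) rfl
      rw [P.extMk_eq_zero_iff _ _ _ _ n rfl]
      obtain ⟨g, hg⟩ := h f hf
      exact ⟨g, hg⟩
    · intro h f hf
      obtain ⟨g, hg⟩ := (P.extMk_eq_zero_iff f (n + 2) rfl hf n rfl).1 (Subsingleton.elim _ _)
      exact ⟨g, hg⟩

section Depth

open IsLocalRing RingTheory.Sequence

theorem coe_le_localRingDepth_iff {R : Type u} [CommRing R] [IsLocalRing R] [IsNoetherianRing R]
    (n : ℕ) : (n : ℕ∞) ≤ localRingDepth R ↔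
      ∃ rs : List R, rs.length = n ∧ (∀ r ∈ rs, r ∈ maximalIdeal R) ∧ IsRegular R rs := by
  have hlt : maximalIdeal R • (⊤ : Submodule R (ModuleCat.of R R)) < ⊤ := by
    rw [lt_top_iff_ne_top]
    simpa using Ideal.IsPrime.ne_top (inferInstance : (maximalIdeal R).IsPrime)
  have hfin : Module.Finite R (ModuleCat.of R R) := inferInstanceAs (Module.Finite R R)
  have hk : Module.Finite R (ModuleCat.of R (ResidueField R)) :=
    inferInstanceAs (Module.Finite R (ResidueField R))
  have hk' : Nontrivial (ModuleCat.of R (ResidueField R)) :=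
    inferInstanceAs (Nontrivial (ResidueField R))
  have hsupp : Module.support R (ModuleCat.of R (ResidueField R)) =
      PrimeSpectrum.zeroLocus (maximalIdeal R : Set R) := by
    change Module.support R (R ⧸ maximalIdeal R) = _
    rw [Module.support_eq_zeroLocus, Ideal.annihilator_quotient]
  have tfae := ModuleCat.exists_isRegular_tfae (maximalIdeal R) n (ModuleCat.of R R) hlt
  refine Iff.trans ?_ (tfae.out 2 3)
  have key : (n : ℕ∞) ≤ localRingDepth R ↔ ∀ i < n, Subsingleton
      (CategoryTheory.Abelian.Ext (ModuleCat.of R (ResidueField R)) (ModuleCat.of R R) i) := by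
    simp only [← subsingleton_extMod_iff]
    rw [localRingDepth, le_sInf_iff]
    constructor
    · intro h i hi
      by_contra hc
      exact absurd (h i ⟨i, rfl, not_subsingleton_iff_nontrivial.1 hc⟩) (by simpa using hi)
    · rintro h _ ⟨m, rfl, hm⟩
      by_contra hc
      exact not_subsingleton_iff_nontrivial.2 hm (h m (by simpa using hc))
  rw [key]
  exact ⟨fun h => ⟨_, hk', hk, hsupp, h⟩, fun h => by
    have := (tfae.out 2 0).1 h
    exact this _ hk' hk hsupp.subset⟩

theorem exists_ne_zero_of_mem_associatedPrimes {R : Type*} [CommRing R] [IsNoetherianRing R]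
    {M : Type*} [AddCommGroup M] [Module R M] {p : Ideal R} (hp : p ∈ associatedPrimes R M) :
    ∃ x : M, x ≠ 0 ∧ ∀ b, b ∈ p ↔ b • x = 0 := by
  obtain ⟨hprime, x, hx⟩ := isAssociatedPrime_iff.1 hp
  have hmem : ∀ b, b ∈ p ↔ b • x = 0 := fun b => by
    rw [hx]; simp [Submodule.mem_colon_singleton]
  refine ⟨x, ?_, hmem⟩
  rintro rfl
  exact hprime.ne_top ((Ideal.eq_top_iff_one p).2 ((hmem 1).2 (smul_zero _)))

open scoped Pointwise in
/-- Every associated prime `p` of `M` is contained in an associated prime of `M / aM`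
containing `a`. -/
theorem exists_mem_associatedPrimes_quotSMulTop {R : Type*} [CommRing R] [IsLocalRing R]
    [IsNoetherianRing R] {M : Type*} [AddCommGroup M] [Module R M] [Module.Finite R M]
    {a : R} (ha : a ∈ maximalIdeal R) (hreg : IsSMulRegular M a) {p : Ideal R}
    (hp : p ∈ associatedPrimes R M) :
    ∃ q ∈ associatedPrimes R (QuotSMulTop a M), p ≤ q ∧ a ∈ q := by
  let N : Submodule R M := Submodule.torsionBySet R M p
  have hN : N ≠ ⊥ := by
    obtain ⟨x, hx0, hx⟩ := exists_ne_zero_of_mem_associatedPrimes hp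
    exact (Submodule.ne_bot_iff _).2
      ⟨x, (Submodule.mem_torsionBySet_iff _ _).2 fun b => (hx b).1 b.2, hx0⟩
  have hx : ∃ x ∈ N, x ∉ a • (⊤ : Submodule R M) := by
    by_contra! hc
    apply hN
    refine Submodule.eq_bot_of_le_smul_of_le_jacobson_bot (Ideal.span {a}) N
      (IsNoetherian.noetherian N) ?_ ?_
    · intro x hx
      obtain ⟨y, -, rfl⟩ := (Submodule.mem_smul_pointwise_iff_exists _ _ _).1 (hc x hx)
      refine Submodule.smul_mem_smul (Ideal.mem_span_singleton_self a) ?_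
      rw [Submodule.mem_torsionBySet_iff] at hx ⊢
      intro b
      apply hreg
      simpa [smul_comm a] using hx b
    · rw [IsLocalRing.jacobson_eq_maximalIdeal ⊥ bot_ne_top]
      exact (Ideal.span_singleton_le_iff_mem _).2 ha
  obtain ⟨x, hxN, hxa⟩ := hx
  have hne : (Submodule.Quotient.mk x : QuotSMulTop a M) ≠ 0 := by
    simpa [Submodule.Quotient.mk_eq_zero] using hxa
  obtain ⟨q, hq, hle⟩ := exists_le_isAssociatedPrime_of_isNoetherianRing R _ hne
  refine ⟨q, hq, fun b hb => hle ?_, hle ?_⟩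
  · rw [Submodule.mem_colon_singleton, ← Submodule.Quotient.mk_smul,
      (Submodule.mem_torsionBySet_iff _ _).1 hxN ⟨b, hb⟩]
    simp
  · rw [Submodule.mem_colon_singleton, ← Submodule.Quotient.mk_smul, Submodule.mem_bot,
      Submodule.Quotient.mk_eq_zero]
    exact Submodule.smul_mem_pointwise_smul _ _ _ trivial

theorem ringKrullDim_quotient_add_one_le {R : Type*} [CommRing R] {p q : Ideal R} [p.IsPrime]
    (hpq : p ≤ q) {a : R} (hap : a ∉ p) (haq : a ∈ q) :
    ringKrullDim (R ⧸ q) + 1 ≤ ringKrullDim (R ⧸ p) := by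
  have ha : Ideal.Quotient.mk p a ∈ nonZeroDivisors (R ⧸ p) :=
    mem_nonZeroDivisors_of_ne_zero (by simpa [Ideal.Quotient.eq_zero_iff_mem] using hap)
  refine le_trans (add_le_add_left ?_ 1) (ringKrullDim_quotient_succ_le_of_nonZeroDivisor ha)
  refine ringKrullDim_le_of_surjective
    (Ideal.Quotient.lift _ (Ideal.Quotient.factor hpq) fun b hb => ?_)
    (Ideal.Quotient.lift_surjective_of_surjective _ _ (Ideal.Quotient.factor_surjective hpq))
  obtain ⟨c, rfl⟩ := Ideal.mem_span_singleton'.1 hb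
  simp [Ideal.Quotient.eq_zero_iff_mem.2 haq]

theorem length_le_ringKrullDim_quotient {R : Type*} [CommRing R] [IsLocalRing R]
    [IsNoetherianRing R] (rs : List R) {M : Type*} [AddCommGroup M] [Module R M]
    [Module.Finite R M] (hmem : ∀ r ∈ rs, r ∈ maximalIdeal R) (hrs : IsWeaklyRegular M rs)
    {p : Ideal R} (hp : p ∈ associatedPrimes R M) :
    (rs.length : WithBot ℕ∞) ≤ ringKrullDim (R ⧸ p) := by
  induction rs generalizing M p with
  | nil =>
    have := hp.isPrime
    simpa using ringKrullDim_nonneg_of_nontrivial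
  | cons a rs ih =>
    have := hp.isPrime
    rw [isWeaklyRegular_cons_iff] at hrs
    obtain ⟨q, hq, hpq, haq⟩ := exists_mem_associatedPrimes_quotSMulTop
      (hmem a List.mem_cons_self) hrs.1 hp
    have hap : a ∉ p := by
      obtain ⟨x, hx0, hx⟩ := exists_ne_zero_of_mem_associatedPrimes hp
      exact fun h => hx0 (hrs.1 (by simpa using (hx a).1 h))
    refine le_trans ?_ (ringKrullDim_quotient_add_one_le hpq hap haq)
    push_cast [List.length_cons]
    exact add_le_add_left (ih (fun r hr => hmem r (List.mem_cons_of_mem _ hr)) hrs.2 hq) 1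

theorem localRingDepth_le_ringKrullDim_quotient {R : Type u} [CommRing R] [IsLocalRing R]
    [IsNoetherianRing R] {p : Ideal R} (hp : p ∈ associatedPrimes R R) :
    (localRingDepth R : WithBot ℕ∞) ≤ ringKrullDim (R ⧸ p) := by
  have := hp.isPrime
  obtain ⟨d, hd⟩ := WithBot.ne_bot_iff_exists.1
    (ne_of_gt ((WithBot.bot_lt_coe 0).trans_le (ringKrullDim_nonneg_of_nontrivial (R := R ⧸ p))))
  rw [← hd, WithBot.coe_le_coe]
  refine ENat.forall_natCast_le_iff_le.1 fun n hn => ?_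
  obtain ⟨rs, rfl, hmem, hrs⟩ := (coe_le_localRingDepth_iff n).1 hn
  have := length_le_ringKrullDim_quotient rs hmem hrs.toIsWeaklyRegular hp
  rw [← hd] at this
  exact_mod_cast this

theorem localRingDepth_le_ringKrullDim (R : Type u) [CommRing R] [IsLocalRing R]
    [IsNoetherianRing R] : (localRingDepth R : WithBot ℕ∞) ≤ ringKrullDim R := by
  obtain ⟨p, hp⟩ := associatedPrimes.nonempty R R
  exact (localRingDepth_le_ringKrullDim_quotient hp).trans (ringKrullDim_quotient_le p)

end Depth

theorem isVertexCover_iff_isIndepSet_compl {V : Type*} {G : SimpleGraph V} {C : Set V} :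
    IsVertexCover G C ↔ IsIndepSet G Cᶜ := by
  constructor
  · intro h u hu v hv _ huv
    exact (h huv).elim hu hv
  · intro h u v huv
    by_contra! hc
    exact h hc.1 hc.2 huv.ne huv

theorem isMinVertexCover_iff_isMaxIndepSet_compl {V : Type*} {G : SimpleGraph V} {C : Set V} :
    IsMinVertexCover G C ↔ IsMaxIndepSet G Cᶜ := by
  unfold IsMinVertexCover IsMaxIndepSet
  rw [isVertexCover_iff_isIndepSet_compl]
  refine and_congr_right fun _ => ⟨fun h B hB hCB => ?_, fun h B hBC hB => ?_⟩
  · rw [← h Bᶜ (Set.compl_subset_comm.1 hCB)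
      (isVertexCover_iff_isIndepSet_compl.2 (by rwa [compl_compl])), compl_compl]
  · exact (compl_injective (h Bᶜ (isVertexCover_iff_isIndepSet_compl.1 hB)
      (Set.compl_subset_compl.2 hBC))).symm

theorem IsIndepSet.exists_isMaxIndepSet {V : Type*} [Finite V] {G : SimpleGraph V} {A : Set V}
    (hA : IsIndepSet G A) : ∃ B, A ⊆ B ∧ IsMaxIndepSet G B := by
  obtain ⟨B, hAB, hB⟩ := (Set.toFinite {B : Set V | IsIndepSet G B}).exists_le_maximal hA
  exact ⟨B, hAB, hB.prop, fun C hC hBC => hB.eq_of_le hC hBC⟩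

theorem IsMaxIndepSet.exists_adj {V : Type*} {G : SimpleGraph V} {A : Set V}
    (hA : IsMaxIndepSet G A) {v : V} (hv : v ∉ A) : ∃ u ∈ A, G.Adj v u := by
  by_contra! h
  refine hv ?_
  rw [hA.2 (insert v A) ?_ (Set.subset_insert v A)]
  · exact Set.mem_insert v A
  · exact hA.1.insert fun u hu _ => ⟨h u hu, fun huv => h u hu huv.symm⟩

theorem IsIndepSet.pair {V : Type*} {G : SimpleGraph V} {u v : V} (huv : ¬ G.Adj u v) :
    IsIndepSet G {u, v} :=
  Set.pairwise_pair.2 fun _ => ⟨huv, fun hvu => huv hvu.symm⟩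

section Perfect

variable {h : ℕ} {G : SimpleGraph (Fin h ⊕ Fin h)}

/-- The index of the matching edge containing a vertex is injective on independent sets. -/
theorem IsIndepSet.injOn_index (hxy : ∀ i : Fin h, G.Adj (Sum.inl i) (Sum.inr i))
    {A : Set (Fin h ⊕ Fin h)} (hA : IsIndepSet G A) : Set.InjOn (Sum.elim id id) A := by
  rintro (i | i) hi (j | j) hj hij <;> obtain rfl : i = j := hij
  · rfl
  · exact absurd (hxy i) (hA hi hj (by simp))
  · exact absurd (hxy i).symm (hA hi hj (by simp))
  · rfl

theorem IsIndepSet.ncard_eq_iff (hxy : ∀ i : Fin h, G.Adj (Sum.inl i) (Sum.inr i))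
    {A : Set (Fin h ⊕ Fin h)} (hA : IsIndepSet G A) :
    A.ncard = h ↔ ∀ j, Sum.inl j ∈ A ∨ Sum.inr j ∈ A := by
  have himg : (Sum.elim id id '' A : Set (Fin h)).ncard = A.ncard :=
    (hA.injOn_index hxy).ncard_image
  rw [← himg]
  constructor
  · intro hc j
    have : (Sum.elim id id '' A : Set (Fin h)) = Set.univ :=
      Set.eq_of_subset_of_ncard_le (Set.subset_univ _) (by simp [hc, Set.ncard_univ])
    obtain ⟨i | i, hi, rfl⟩ := this.symm ▸ Set.mem_univ j
    · exact Or.inl hi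
    · exact Or.inr hi
  · intro hj
    have : (Sum.elim id id '' A : Set (Fin h)) = Set.univ :=
      Set.eq_univ_of_forall fun j => (hj j).elim (fun hm => ⟨_, hm, rfl⟩) fun hm => ⟨_, hm, rfl⟩
    rw [this, Set.ncard_univ, Nat.card_eq_fintype_card, Fintype.card_fin]

theorem ncard_compl_eq_iff (C : Set (Fin h ⊕ Fin h)) : Cᶜ.ncard = h ↔ C.ncard = h := by
  have := Set.ncard_add_ncard_compl C
  rw [Nat.card_eq_fintype_card, Fintype.card_sum, Fintype.card_fin] at this
  lia

theorem isUnmixedGraph_iff_forall_mem (hstar : CondStar G) :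
    IsUnmixedGraph G ↔
      ∀ A, IsMaxIndepSet G A → ∀ j, Sum.inl j ∈ A ∨ Sum.inr j ∈ A := by
  have hX : (Set.range (Sum.inl : Fin h → Fin h ⊕ Fin h)).ncard = h := by
    rw [← Set.image_univ, Set.ncard_image_of_injective _ Sum.inl_injective, Set.ncard_univ,
      Nat.card_eq_fintype_card, Fintype.card_fin]
  constructor
  · intro hu A hA
    rw [← hA.1.ncard_eq_iff hstar.2.2, ← ncard_compl_eq_iff]
    exact (hu _ _ (isMinVertexCover_iff_isMaxIndepSet_compl.2 (by rwa [compl_compl]))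
      hstar.1).trans hX
  · intro hA
    have hC : ∀ C, IsMinVertexCover G C → C.ncard = h := fun C hC => by
      have hC' := isMinVertexCover_iff_isMaxIndepSet_compl.1 hC
      rw [← ncard_compl_eq_iff, hC'.1.ncard_eq_iff hstar.2.2]
      exact hA _ hC'
    exact fun C₁ C₂ h₁ h₂ => (hC C₁ h₁).trans (hC C₂ h₂).symm

theorem isUnmixedGraph_iff_conditions (hstar : CondStar G) :
    IsUnmixedGraph G ↔
      ((∀ i j k : Fin h, i ≠ j → j ≠ k → i ≠ k → ∀ z : Fin h ⊕ Fin h,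
          (z = Sum.inl i ∨ z = Sum.inr i) →
          G.Adj z (Sum.inl j) → G.Adj (Sum.inr j) (Sum.inl k) → G.Adj z (Sum.inl k)) ∧
        (∀ i j : Fin h, G.Adj (Sum.inl i) (Sum.inr j) →
          ¬ G.Adj (Sum.inl i) (Sum.inl j))) := by
  have hindep : ∀ {A} {u v : Fin h ⊕ Fin h}, IsMaxIndepSet G A → u ∈ A → v ∈ A → ¬ G.Adj u v :=
    fun hA hu hv huv => hA.1 hu hv huv.ne huv
  rw [isUnmixedGraph_iff_forall_mem hstar]
  constructor
  · refine fun hu => ⟨fun i j k _ _ _ z _ hzj hjk => ?_, fun i j hij hij' => ?_⟩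
    · by_contra hzk
      obtain ⟨A, hsub, hA⟩ := (IsIndepSet.pair hzk).exists_isMaxIndepSet
      rcases hu A hA j with hj | hj
      · exact hindep hA (hsub (by simp)) hj hzj
      · exact hindep hA hj (hsub (by simp)) hjk
    · obtain ⟨A, hsub, hA⟩ :=
        IsIndepSet.exists_isMaxIndepSet (Set.pairwise_singleton (Sum.inl i) _ : IsIndepSet G _)
      rcases hu A hA j with hj | hj
      · exact hindep hA (hsub rfl) hj hij'
      · exact hindep hA (hsub rfl) hj hij
  · rintro ⟨h1, h2⟩ A hA j
    by_contra! hj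
    obtain ⟨z, hzA, hz⟩ := hA.exists_adj hj.1
    obtain ⟨w, hwA, hw⟩ := hA.exists_adj hj.2
    have hzw := hindep hA hzA hwA
    obtain k | k := w
    · have hjk : j ≠ k := by rintro rfl; exact hj.1 hwA
      obtain ⟨i, hi⟩ : ∃ i, z = Sum.inl i ∨ z = Sum.inr i := by
        rcases z with i | i <;> exact ⟨i, by simp⟩
      have hij : i ≠ j := by
        rintro rfl
        rcases hi with rfl | rfl
        · exact hj.1 hzA
        · exact hj.2 hzA
      by_cases hik : i = k
      · subst hik
        rcases hi with rfl | rfl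
        · exact h2 _ _ hw.symm hz.symm
        · exact hzw (hstar.2.2 i).symm
      · exact hzw (h1 i j k hij hjk hik z hi hz.symm hw)
    · exact hstar.2.1.1 ⟨j, rfl⟩ ⟨k, rfl⟩ hw.ne hw

end Perfect

section MonicSequence

open RingTheory.Sequence

theorem isWeaklyRegular_monic_cons {B : Type*} [CommRing B] {g : Polynomial B} (hg : g.Monic)
    {rs : List B} (hrs : IsWeaklyRegular B rs) :
    IsWeaklyRegular (Polynomial B) (g :: rs.map Polynomial.C) := by
  have hfree : Module.Free B (Polynomial B ⧸ Ideal.span {g}) := hg.free_quotient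
  refine (isWeaklyRegular_cons_iff _ _ _).2 ⟨hg.isRegular.left, ?_⟩
  let e : QuotSMulTop g (Polynomial B) ≃ₗ[Polynomial B] Polynomial B ⧸ Ideal.span {g} :=
    Submodule.quotEquivOfEq _ _ (by
      rw [← Submodule.ideal_span_singleton_smul, smul_eq_mul, Ideal.mul_top])
  rw [e.isWeaklyRegular_congr]
  have h1 : IsWeaklyRegular (Polynomial B ⧸ Ideal.span {g}) (rs.map (algebraMap B _)) :=
    hrs.of_flat
  rw [isWeaklyRegular_map_algebraMap_iff] at h1
  exact (isWeaklyRegular_map_algebraMap_iff (Polynomial B) _ rs).2 h1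

theorem isWeaklyRegular_ofFn_aeval_X {K : Type*} [CommRing K] {n : ℕ} (f : Fin n → Polynomial K)
    (hf : ∀ i, (f i).Monic) :
    IsWeaklyRegular (MvPolynomial (Fin n) K)
      (List.ofFn fun i => Polynomial.aeval (MvPolynomial.X i : MvPolynomial (Fin n) K) (f i)) := by
  induction n with
  | zero => simp
  | succ n ih =>
    have h1 := isWeaklyRegular_monic_cons ((hf 0).map (MvPolynomial.C (σ := Fin n)))
      (ih (fun i => f i.succ) fun i => hf _)
    refine (AddEquiv.isWeaklyRegular_congr
      (e := (MvPolynomial.finSuccEquiv K n).toAddEquiv) ?_).2 h1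
    have key : (MvPolynomial.finSuccEquiv K n (Polynomial.aeval (MvPolynomial.X 0) (f 0)) ::
        List.ofFn fun i : Fin n => MvPolynomial.finSuccEquiv K n
          (Polynomial.aeval (MvPolynomial.X i.succ) (f i.succ))) =
        (f 0).map (MvPolynomial.C (σ := Fin n)) ::
          (List.ofFn fun i : Fin n => Polynomial.aeval
            (MvPolynomial.X i : MvPolynomial (Fin n) K) (f i.succ)).map Polynomial.C := by
      simp only [← Polynomial.aeval_algHom_apply, MvPolynomial.finSuccEquiv_X_zero,
        MvPolynomial.finSuccEquiv_X_succ, List.map_ofFn]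
      congr 1
      congr 1
      funext i
      exact Polynomial.aeval_algebraMap_apply _ _ _
    rw [← key, List.ofFn_succ]
    refine List.Forall₂.cons (fun x => map_mul (MvPolynomial.finSuccEquiv K n) _ x) ?_
    rw [List.forall₂_iff_get]
    refine ⟨by simp, fun i h1 h2 x => ?_⟩
    simp

end MonicSequence

section FreeCohenMacaulay

open RingTheory.Sequence

theorem ringKrullDim_le_of_isIntegral (A R : Type*) [CommRing A] [CommRing R] [Algebra A R]
    [Algebra.IsIntegral A R] : ringKrullDim R ≤ ringKrullDim A :=
  Order.krullDim_le_of_strictMono (PrimeSpectrum.comap (algebraMap A R)) fun _ _ h =>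
    Ideal.IsIntegral.comap_lt_comap h

/-- For every maximal ideal `p` of an algebra of finite type over a field `K` and every `x`,
some monic polynomial over `K` takes a value in `p` at `x`. -/
theorem exists_monic_aeval_mem {K R : Type*} [Field K] [CommRing R] [Algebra K R]
    [Algebra.FiniteType K R] (p : Ideal R) [p.IsMaximal] (x : R) :
    ∃ f : Polynomial K, f.Monic ∧ Polynomial.aeval x f ∈ p := by
  let := Ideal.Quotient.field p
  have : Module.Finite K (R ⧸ p) := finite_of_finite_type_of_isJacobsonRing K (R ⧸ p)
  have hintegral : IsIntegral K (Ideal.Quotient.mkₐ K p x) := Algebra.IsIntegral.isIntegral _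
  refine ⟨minpoly K (Ideal.Quotient.mkₐ K p x), minpoly.monic hintegral, ?_⟩
  rw [← Ideal.Quotient.eq_zero_iff_mem, ← Ideal.Quotient.mkₐ_eq_mk K,
    ← Polynomial.aeval_algHom_apply, minpoly.aeval]

theorem isCohenMacaulayRing_of_finite_of_free {K : Type*} {R : Type u} [Field K] [CommRing R]
    {n : ℕ} [Algebra K R] [Algebra (MvPolynomial (Fin n) K) R]
    [IsScalarTower K (MvPolynomial (Fin n) K) R] [Module.Finite (MvPolynomial (Fin n) K) R]
    [Module.Free (MvPolynomial (Fin n) K) R] : IsCohenMacaulayRing R := by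
  have hft : Algebra.FiniteType K R :=
    Algebra.FiniteType.trans (S := MvPolynomial (Fin n) K) inferInstance inferInstance
  have hnoeth : IsNoetherianRing R := Algebra.FiniteType.isNoetherianRing K R
  intro p hp
  have hdim : ringKrullDim (Localization.AtPrime p) ≤ n := by
    rw [IsLocalization.AtPrime.ringKrullDim_eq_height p]
    refine (Ideal.height_le_ringKrullDim_of_ne_top hp.ne_top).trans ?_
    refine (ringKrullDim_le_of_isIntegral (MvPolynomial (Fin n) K) R).trans ?_
    simp [MvPolynomial.ringKrullDim_of_isNoetherianRing]
  have hdepth : (n : ℕ∞) ≤ localRingDepth (Localization.AtPrime p) := by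
    choose f hf hfp using fun i : Fin n =>
      exists_monic_aeval_mem (K := K) p (algebraMap (MvPolynomial (Fin n) K) R (MvPolynomial.X i))
    have hreg := (isWeaklyRegular_ofFn_aeval_X f hf).of_flat (S := R)
    have hmem : ∀ r ∈ (List.ofFn fun i => Polynomial.aeval
        (MvPolynomial.X i : MvPolynomial (Fin n) K) (f i)).map (algebraMap _ R), r ∈ p := by
      simp only [List.map_ofFn, List.forall_mem_ofFn_iff]
      intro i
      simpa only [Function.comp_apply, Polynomial.aeval_algebraMap_apply] using hfp i
    refine (coe_le_localRingDepth_iff n).2 ⟨_, ?_, ?_,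
      hreg.isRegular_of_isLocalization_of_mem (Localization.AtPrime p) p hmem⟩
    · simp
    · intro r hr
      obtain ⟨s, hs, rfl⟩ := List.mem_map.1 hr
      exact (IsLocalization.AtPrime.to_map_mem_maximal_iff _ p s).2 (hmem s hs)
  refine le_antisymm (localRingDepth_le_ringKrullDim _) (hdim.trans ?_)
  exact_mod_cast hdepth

end FreeCohenMacaulay

section FreeBasis

/-- A family of vectors that is triangular with respect to a family of linear forms
is linearly independent. -/
theorem linearIndependent_of_triangular {ι A M : Type*} [CommRing A] [IsDomain A]
    [AddCommGroup M] [Module A M] (v : ι → M) (φ : ι → M →ₗ[A] A) (f : ι → ℕ)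
    (hdiag : ∀ i, φ i (v i) ≠ 0) (htri : ∀ i j, φ i (v j) ≠ 0 → j = i ∨ f j < f i) :
    LinearIndependent A v := by
  rw [linearIndependent_iff]
  intro c hc
  by_contra hne
  obtain ⟨i, hi, hmin⟩ := Finset.exists_min_image c.support f (Finsupp.support_nonempty_iff.2 hne)
  have h0 : φ i (Finsupp.linearCombination A v c) = 0 := by rw [hc, map_zero]
  rw [Finsupp.linearCombination_apply, Finsupp.sum, map_sum, Finset.sum_eq_single i] at h0
  · rw [map_smul, smul_eq_mul, mul_eq_zero] at h0
    exact h0.elim (Finsupp.mem_support_iff.1 hi) (hdiag i)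
  · intro j hj hji
    rw [map_smul, smul_eq_mul]
    refine mul_eq_zero_of_right _ ?_
    by_contra hφ
    exact (htri i j hφ).elim hji (not_lt.2 (hmin j hj))
  · exact fun h => absurd hi h

variable {h : ℕ}

/-- A set of indices is admissible if the `x_i` it selects are pairwise non-adjacent, and
`x_i` is not adjacent to `y_j` for distinct selected `i` and `j`. -/
def IsAdmissible (G : SimpleGraph (Fin h ⊕ Fin h)) (T : Finset (Fin h)) : Prop :=
  ∀ i ∈ T, ∀ j ∈ T, i ≠ j →
    ¬ G.Adj (Sum.inl i) (Sum.inl j) ∧ ¬ G.Adj (Sum.inl i) (Sum.inr j)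

open Classical in
/-- The indices `j` for which `y_j` is adjacent to some `x_i` with `i ∈ T`. -/
noncomputable def upperIndices (G : SimpleGraph (Fin h ⊕ Fin h)) (T : Finset (Fin h)) :
    Finset (Fin h) :=
  {j | ∃ i ∈ T, G.Adj (Sum.inl i) (Sum.inr j)}

variable {G : SimpleGraph (Fin h ⊕ Fin h)}

theorem mem_upperIndices {T : Finset (Fin h)} {j : Fin h} :
    j ∈ upperIndices G T ↔ ∃ i ∈ T, G.Adj (Sum.inl i) (Sum.inr j) := by
  simp [upperIndices]

theorem IsAdmissible.mono {T U : Finset (Fin h)} (hT : IsAdmissible G T) (hUT : U ⊆ T) :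
    IsAdmissible G U :=
  fun i hi j hj => hT i (hUT hi) j (hUT hj)

section Span

variable {A R : Type*} [CommRing A] [CommRing R] [Algebra A R] {z : Fin h ⊕ Fin h → R}
  {t : Fin h → A}

theorem mul_prod_mem_span_admissible (hz : ∀ u v, G.Adj u v → z u * z v = 0)
    (ht : ∀ i, algebraMap A R (t i) = z (Sum.inl i) - z (Sum.inr i))
    (hxy : ∀ i, G.Adj (Sum.inl i) (Sum.inr i)) (T : Finset (Fin h)) (hT : IsAdmissible G T)
    (i : Fin h) :
    z (Sum.inl i) * ∏ j ∈ T, z (Sum.inl j) ∈ Submodule.span A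
      (Set.range fun U : {U : Finset (Fin h) // IsAdmissible G U} =>
        ∏ j ∈ U.1, z (Sum.inl j)) := by
  classical
  have hmul : ∀ i j, G.Adj (Sum.inl i) (Sum.inr j) →
      z (Sum.inl i) * z (Sum.inl j) = t j • z (Sum.inl i) := by
    intro i j hij
    rw [Algebra.smul_def, ht, sub_mul, mul_comm (z (Sum.inr j)), hz _ _ hij, sub_zero, mul_comm]
  have hbasis : ∀ U : Finset (Fin h), IsAdmissible G U → ∏ j ∈ U, z (Sum.inl j) ∈
      Submodule.span A (Set.range fun U : {U : Finset (Fin h) // IsAdmissible G U} =>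
        ∏ j ∈ U.1, z (Sum.inl j)) :=
    fun U hU => Submodule.subset_span ⟨⟨U, hU⟩, rfl⟩
  have hscale : ∀ (T : Finset (Fin h)) (i j : Fin h), j ∈ T →
      G.Adj (Sum.inl j) (Sum.inr i) →
      z (Sum.inl i) * ∏ j ∈ T, z (Sum.inl j) = t i • ∏ j ∈ T, z (Sum.inl j) := by
    intro T i j hj hji
    rw [← Finset.mul_prod_erase T _ hj, ← mul_assoc, mul_comm (z (Sum.inl i)), hmul j i hji,
      smul_mul_assoc]
  induction T using Finset.strongInduction with
  | H T ih =>
    by_cases hiT : i ∈ T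
    · rw [hscale T i i hiT (hxy i)]
      exact Submodule.smul_mem _ _ (hbasis T hT)
    by_cases hins : IsAdmissible G (insert i T)
    · have hmem := hbasis _ hins
      rwa [Finset.prod_insert hiT] at hmem
    have hbad : ∃ j ∈ T, G.Adj (Sum.inl i) (Sum.inl j) ∨ G.Adj (Sum.inl j) (Sum.inr i) ∨
        G.Adj (Sum.inl i) (Sum.inr j) := by
      by_contra! hgood
      refine hins fun a ha b hb hab => ?_
      rcases Finset.mem_insert.1 ha with rfl | ha' <;>
        rcases Finset.mem_insert.1 hb with rfl | hb'
      · exact absurd rfl hab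
      · exact ⟨(hgood b hb').1, (hgood b hb').2.2⟩
      · exact ⟨fun hba => (hgood a ha').1 hba.symm, (hgood a ha').2.1⟩
      · exact hT a ha' b hb' hab
    obtain ⟨j, hj, hij | hji | hij⟩ := hbad
    · rw [← Finset.mul_prod_erase T _ hj, ← mul_assoc, hz _ _ hij, zero_mul]
      exact Submodule.zero_mem _
    · rw [hscale T i j hj hji]
      exact Submodule.smul_mem _ _ (hbasis T hT)
    · rw [← Finset.mul_prod_erase T _ hj, ← mul_assoc, hmul i j hij, smul_mul_assoc]
      refine Submodule.smul_mem _ _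
        (ih _ (Finset.erase_ssubset hj) (hT.mono (Finset.erase_subset _ _)))

theorem span_admissible_eq_top (hz : ∀ u v, G.Adj u v → z u * z v = 0)
    (ht : ∀ i, algebraMap A R (t i) = z (Sum.inl i) - z (Sum.inr i))
    (hxy : ∀ i, G.Adj (Sum.inl i) (Sum.inr i))
    (htop : Algebra.adjoin A (Set.range fun i => z (Sum.inl i)) = ⊤) :
    Submodule.span A (Set.range fun U : {U : Finset (Fin h) // IsAdmissible G U} =>
      ∏ j ∈ U.1, z (Sum.inl j)) = ⊤ := by
  set M := Submodule.span A (Set.range fun U : {U : Finset (Fin h) // IsAdmissible G U} =>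
      ∏ j ∈ U.1, z (Sum.inl j)) with hM
  have hmul : ∀ r : R, ∀ m ∈ M, r * m ∈ M := by
    intro r
    have hr : r ∈ Algebra.adjoin A (Set.range fun i => z (Sum.inl i)) := htop ▸ Algebra.mem_top
    induction hr using Algebra.adjoin_induction with
    | mem r hr =>
      obtain ⟨i, rfl⟩ := hr
      intro m hm
      induction hm using Submodule.span_induction with
      | mem m hm =>
        obtain ⟨U, rfl⟩ := hm
        exact mul_prod_mem_span_admissible hz ht hxy U.1 U.2 i
      | zero => simp
      | add a b _ _ ha hb => rw [mul_add]; exact add_mem ha hb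
      | smul c a _ ha => rw [mul_smul_comm]; exact M.smul_mem c ha
    | algebraMap a => intro m hm; rw [← Algebra.smul_def]; exact M.smul_mem a hm
    | add a b _ _ ha hb => intro m hm; rw [add_mul]; exact add_mem (ha m hm) (hb m hm)
    | mul a b _ _ ha hb => intro m hm; rw [mul_assoc]; exact ha _ (hb m hm)
  have hone : (1 : R) ∈ M := Submodule.subset_span ⟨⟨∅, by simp [IsAdmissible]⟩, by simp⟩
  exact eq_top_iff.2 fun r _ => mul_one r ▸ hmul r 1 hone

end Span

section Conditions

theorem upperIndices_subset
    (htrans : ∀ i j k : Fin h, G.Adj (Sum.inl i) (Sum.inr j) → G.Adj (Sum.inl j) (Sum.inr k) →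
      G.Adj (Sum.inl i) (Sum.inr k))
    {T U : Finset (Fin h)} (hUT : U ⊆ upperIndices G T) :
    upperIndices G U ⊆ upperIndices G T := by
  intro k hk
  obtain ⟨j, hj, hjk⟩ := mem_upperIndices.1 hk
  obtain ⟨i, hi, hij⟩ := mem_upperIndices.1 (hUT hj)
  exact mem_upperIndices.2 ⟨i, hi, htrans i j k hij hjk⟩

theorem subset_upperIndices (hxy : ∀ i, G.Adj (Sum.inl i) (Sum.inr i)) (T : Finset (Fin h)) :
    T ⊆ upperIndices G T :=
  fun i hi => mem_upperIndices.2 ⟨i, hi, hxy i⟩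

/-- An admissible set is determined by the up-set it generates, being its set of minimal
elements. -/
theorem IsAdmissible.subset_of_upperIndices_eq (hxy : ∀ i, G.Adj (Sum.inl i) (Sum.inr i))
    (hle : ∀ i j : Fin h, G.Adj (Sum.inl i) (Sum.inr j) → i ≤ j)
    (htrans : ∀ i j k : Fin h, G.Adj (Sum.inl i) (Sum.inr j) → G.Adj (Sum.inl j) (Sum.inr k) →
      G.Adj (Sum.inl i) (Sum.inr k))
    {T U : Finset (Fin h)} (hT : IsAdmissible G T) (hTU : upperIndices G T = upperIndices G U) :
    T ⊆ U := by
  intro i hi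
  obtain ⟨j, hj, hji⟩ := mem_upperIndices.1 (hTU ▸ subset_upperIndices hxy T hi)
  obtain ⟨k, hk, hkj⟩ := mem_upperIndices.1 (hTU.symm ▸ subset_upperIndices hxy U hj)
  obtain rfl : k = i := by
    by_contra hki
    exact (hT k hk i hi hki).2 (htrans k j i hkj hji)
  obtain rfl : j = k := le_antisymm (hle _ _ hji) (hle _ _ hkj)
  exact hj

variable {A R : Type*} [CommRing A] [IsDomain A] [CommRing R] [Algebra A R]
  {z : Fin h ⊕ Fin h → R} {t : Fin h → A}

open Classical in
theorem linearIndependent_admissible (hxy : ∀ i, G.Adj (Sum.inl i) (Sum.inr i))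
    (hle : ∀ i j : Fin h, G.Adj (Sum.inl i) (Sum.inr j) → i ≤ j)
    (htrans : ∀ i j k : Fin h, G.Adj (Sum.inl i) (Sum.inr j) → G.Adj (Sum.inl j) (Sum.inr k) →
      G.Adj (Sum.inl i) (Sum.inr k))
    (ht : ∀ i, t i ≠ 0)
    (hφ : ∀ T : Finset (Fin h), IsAdmissible G T → ∃ φ : R →ₐ[A] A,
      ∀ i, φ (z (Sum.inl i)) = if i ∈ upperIndices G T then t i else 0) :
    LinearIndependent A fun U : {U : Finset (Fin h) // IsAdmissible G U} =>
      ∏ j ∈ U.1, z (Sum.inl j) := by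
  choose φ hφ using hφ
  refine linearIndependent_of_triangular _ (fun U => (φ U.1 U.2).toLinearMap)
    (fun U => (upperIndices G U.1).card) (fun U => ?_) fun U V hUV => ?_
  · simp only [AlgHom.toLinearMap_apply, map_prod, hφ]
    refine Finset.prod_ne_zero_iff.2 fun i hi => ?_
    rw [if_pos (subset_upperIndices hxy _ hi)]
    exact ht i
  · simp only [AlgHom.toLinearMap_apply, map_prod, hφ] at hUV
    have hsub : V.1 ⊆ upperIndices G U.1 := by
      intro i hi
      by_contra hiU
      exact Finset.prod_ne_zero_iff.1 hUV i hi (if_neg hiU)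
    rcases (upperIndices_subset htrans hsub).eq_or_ssubset with heq | hss
    · exact Or.inl (Subtype.ext ((V.2.subset_of_upperIndices_eq hxy hle htrans heq).antisymm
        (U.2.subset_of_upperIndices_eq hxy hle htrans heq.symm)))
    · exact Or.inr (Finset.card_lt_card hss)

end Conditions

section Quotient

variable (K : Type*) [Field K]

theorem mk_X_mul_mk_X_eq_zero {V : Type*} {G : SimpleGraph V} {u v : V} (huv : G.Adj u v) :
    Ideal.Quotient.mk (edgeIdeal K G) (MvPolynomial.X u) *
      Ideal.Quotient.mk (edgeIdeal K G) (MvPolynomial.X v) = 0 := by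
  rw [← map_mul, Ideal.Quotient.eq_zero_iff_mem]
  exact Ideal.subset_span ⟨s(u, v), huv, rfl⟩

theorem edgeIdeal_le_iff {V : Type*} {G : SimpleGraph V} {J : Ideal (MvPolynomial V K)} :
    edgeIdeal K G ≤ J ↔ ∀ u v, G.Adj u v → MvPolynomial.X u * MvPolynomial.X v ∈ J := by
  rw [edgeIdeal, Ideal.span_le, Set.image_subset_iff]
  refine ⟨fun hJ u v huv => hJ (show s(u, v) ∈ G.edgeSet from huv), fun hJ e => ?_⟩
  induction e using Sym2.ind with
  | _ u v => exact fun huv => hJ u v huv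

/-- The homomorphism sending the variable `t_i` to `x_i - y_i` in the edge ring. -/
noncomputable def differenceHom (G : SimpleGraph (Fin h ⊕ Fin h)) :
    MvPolynomial (Fin h) K →ₐ[K] MvPolynomial (Fin h ⊕ Fin h) K ⧸ edgeIdeal K G :=
  MvPolynomial.aeval fun i =>
    Ideal.Quotient.mk _ (MvPolynomial.X (Sum.inl i)) -
      Ideal.Quotient.mk _ (MvPolynomial.X (Sum.inr i))

open Classical in
/-- The retraction of `differenceHom` attached to an index set `C` such that the `x_i` with
`i ∈ C` and the `y_i` with `i ∉ C` form an independent set. -/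
theorem exists_retraction_differenceHom (C : Finset (Fin h))
    (hxx : ∀ i ∈ C, ∀ j ∈ C, ¬ G.Adj (Sum.inl i) (Sum.inl j))
    (hxy : ∀ i ∈ C, ∀ j, G.Adj (Sum.inl i) (Sum.inr j) → j ∈ C)
    (hyy : ∀ i j : Fin h, ¬ G.Adj (Sum.inr i) (Sum.inr j)) :
    ∃ ψ : (MvPolynomial (Fin h ⊕ Fin h) K ⧸ edgeIdeal K G) →ₐ[K] MvPolynomial (Fin h) K,
      ψ.comp (differenceHom K G) = AlgHom.id K _ ∧
      ∀ i, ψ (Ideal.Quotient.mk _ (MvPolynomial.X (Sum.inl i))) =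
        if i ∈ C then MvPolynomial.X i else 0 := by
  let w : Fin h ⊕ Fin h → MvPolynomial (Fin h) K :=
    Sum.elim (fun i => if i ∈ C then MvPolynomial.X i else 0)
      fun i => if i ∈ C then 0 else -MvPolynomial.X i
  have hw : edgeIdeal K G ≤ RingHom.ker (MvPolynomial.aeval w : _ →ₐ[K] _) := by
    rw [edgeIdeal_le_iff]
    rintro (i | i) (j | j) hij <;>
      simp only [RingHom.mem_ker, map_mul, MvPolynomial.aeval_X, w, Sum.elim_inl, Sum.elim_inr]
    · by_cases hi : i ∈ C <;> by_cases hj : j ∈ C <;> simp [hi, hj]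
      exact hxx i hi j hj hij
    · by_cases hi : i ∈ C <;> by_cases hj : j ∈ C <;> simp [hi, hj]
      exact hj (hxy i hi j hij)
    · by_cases hi : i ∈ C <;> by_cases hj : j ∈ C <;> simp [hi, hj]
      exact hi (hxy j hj i hij.symm)
    · exact absurd hij (hyy i j)
  have hmk : ∀ v, Ideal.Quotient.liftₐ (edgeIdeal K G) (MvPolynomial.aeval w) hw
      (Ideal.Quotient.mk _ (MvPolynomial.X v)) = w v := fun v =>
    (Ideal.Quotient.lift_mk _ _ hw).trans (MvPolynomial.aeval_X w v)
  refine ⟨Ideal.Quotient.liftₐ (edgeIdeal K G) (MvPolynomial.aeval w) hw, ?_, fun i => hmk _⟩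
  refine MvPolynomial.algHom_ext fun i => ?_
  rw [AlgHom.comp_apply, differenceHom, MvPolynomial.aeval_X, map_sub, hmk, hmk, AlgHom.id_apply]
  simp only [w, Sum.elim_inl, Sum.elim_inr]
  split_ifs <;> simp

end Quotient

end FreeBasis

theorem isCohenMacaulayRing_of_conditions {h : ℕ} (K : Type u) [Field K]
    {G : SimpleGraph (Fin h ⊕ Fin h)}
    (hxy : ∀ i : Fin h, G.Adj (Sum.inl i) (Sum.inr i))
    (hle : ∀ i j : Fin h, G.Adj (Sum.inl i) (Sum.inr j) → i ≤ j)
    (hyy : ∀ i j : Fin h, ¬ G.Adj (Sum.inr i) (Sum.inr j))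
    (h1 : ∀ i j k : Fin h, i ≠ j → j ≠ k → i ≠ k → ∀ z : Fin h ⊕ Fin h,
      (z = Sum.inl i ∨ z = Sum.inr i) →
      G.Adj z (Sum.inl j) → G.Adj (Sum.inr j) (Sum.inl k) → G.Adj z (Sum.inl k))
    (h2 : ∀ i j : Fin h, G.Adj (Sum.inl i) (Sum.inr j) → ¬ G.Adj (Sum.inl i) (Sum.inl j)) :
    IsCohenMacaulayRing (MvPolynomial (Fin h ⊕ Fin h) K ⧸ edgeIdeal K G) := by
  classical
  have htrans : ∀ i j k : Fin h, G.Adj (Sum.inl i) (Sum.inr j) →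
      G.Adj (Sum.inl j) (Sum.inr k) → G.Adj (Sum.inl i) (Sum.inr k) := by
    intro i j k hij hjk
    rcases eq_or_ne i j with rfl | hne
    · exact hjk
    rcases eq_or_ne j k with rfl | hne'
    · exact hij
    have hik : k ≠ i := by
      rintro rfl
      exact hne (le_antisymm (hle _ _ hij) (hle _ _ hjk))
    exact (h1 k j i hne'.symm hne.symm hik _ (Or.inr rfl) hjk.symm hij.symm).symm
  have hxx : ∀ a i j : Fin h, G.Adj (Sum.inl a) (Sum.inr i) →
      G.Adj (Sum.inl i) (Sum.inl j) → G.Adj (Sum.inl a) (Sum.inl j) := by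
    intro a i j hai hij
    rcases eq_or_ne a i with rfl | hne
    · exact hij
    have hji : j ≠ i := by rintro rfl; exact hij.ne rfl
    have hja : j ≠ a := by rintro rfl; exact h2 _ _ hai hij.symm
    exact (h1 j i a hji hne.symm hja _ (Or.inl rfl) hij.symm hai.symm).symm
  let hA : Algebra (MvPolynomial (Fin h) K)
      (MvPolynomial (Fin h ⊕ Fin h) K ⧸ edgeIdeal K G) := (differenceHom K G).toRingHom.toAlgebra
  let : Module (MvPolynomial (Fin h) K)
      (MvPolynomial (Fin h ⊕ Fin h) K ⧸ edgeIdeal K G) := hA.toModule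
  have hsub : ∀ i, algebraMap (MvPolynomial (Fin h) K)
      (MvPolynomial (Fin h ⊕ Fin h) K ⧸ edgeIdeal K G) (MvPolynomial.X i) =
      Ideal.Quotient.mk _ (MvPolynomial.X (Sum.inl i)) -
        Ideal.Quotient.mk _ (MvPolynomial.X (Sum.inr i)) := fun i => MvPolynomial.aeval_X _ i
  have htower : IsScalarTower K (MvPolynomial (Fin h) K)
      (MvPolynomial (Fin h ⊕ Fin h) K ⧸ edgeIdeal K G) :=
    IsScalarTower.of_algHom (differenceHom K G)
  let z : Fin h ⊕ Fin h → MvPolynomial (Fin h ⊕ Fin h) K ⧸ edgeIdeal K G :=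
    fun v => Ideal.Quotient.mk _ (MvPolynomial.X v)
  have hspan := span_admissible_eq_top (G := G) (z := z)
    (fun u v huv => mk_X_mul_mk_X_eq_zero K huv) hsub hxy (by
      refine Algebra.eq_top_iff.2 fun r => ?_
      obtain ⟨p, rfl⟩ := Ideal.Quotient.mk_surjective r
      have hl : ∀ i, z (Sum.inl i) ∈ Algebra.adjoin (MvPolynomial (Fin h) K)
        (Set.range fun i => z (Sum.inl i)) := fun i => Algebra.subset_adjoin ⟨i, rfl⟩
      induction p using MvPolynomial.induction_on with
      | C a =>
        have ha : Ideal.Quotient.mk (edgeIdeal K G) (MvPolynomial.C a) =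
            algebraMap (MvPolynomial (Fin h) K) _ (MvPolynomial.C a) :=
          ((differenceHom K G).commutes a).symm
        rw [ha]
        exact Subalgebra.algebraMap_mem _ _
      | add p q hp hq => rw [map_add]; exact add_mem hp hq
      | mul_X p v hp =>
        rw [map_mul]
        refine mul_mem hp ?_
        rcases v with i | i
        · exact hl i
        · have hi : z (Sum.inr i) = z (Sum.inl i) -
              algebraMap (MvPolynomial (Fin h) K) _ (MvPolynomial.X i) := by
            rw [hsub, sub_sub_cancel]
          change z (Sum.inr i) ∈ _
          rw [hi]
          exact sub_mem (hl i) (Subalgebra.algebraMap_mem _ _))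
  have hli := linearIndependent_admissible (G := G) (z := z)
    (t := fun i => (MvPolynomial.X i : MvPolynomial (Fin h) K)) hxy hle htrans
    (fun i => MvPolynomial.X_ne_zero i) (by
      intro T hT
      obtain ⟨ψ, hψ, hψX⟩ := exists_retraction_differenceHom (G := G) K (upperIndices G T) (by
          intro i hi j hj hij
          obtain ⟨a, ha, hai⟩ := mem_upperIndices.1 hi
          obtain ⟨b, hb, hbj⟩ := mem_upperIndices.1 hj
          have hba := hxx b j a hbj (hxx a i j hai hij).symm
          exact (hT b hb a ha fun hab => hba.ne (congrArg Sum.inl hab)).1 hba) (by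
          intro i hi j hij
          obtain ⟨a, ha, hai⟩ := mem_upperIndices.1 hi
          exact mem_upperIndices.2 ⟨a, ha, htrans a i j hai hij⟩) hyy
      exact ⟨{ ψ.toRingHom with commutes' := fun a => DFunLike.congr_fun hψ a }, hψX⟩)
  have hfree := Module.Free.of_basis (Module.Basis.mk hli hspan.ge)
  have hfinite : Module.Finite (MvPolynomial (Fin h) K)
      (MvPolynomial (Fin h ⊕ Fin h) K ⧸ edgeIdeal K G) :=
    Module.Finite.of_basis (Module.Basis.mk hli hspan.ge)
  exact isCohenMacaulayRing_of_finite_of_free (K := K) (n := h)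

section Unmixed

open IsLocalRing

theorem ringKrullDim_quotient_sup_span_singleton_add_one {B : Type*} [CommRing B] [IsLocalRing B]
    [IsNoetherianRing B] (p : Ideal B) [p.IsPrime] {x : B} (hx : x ∈ maximalIdeal B)
    (hxp : x ∉ p) : ringKrullDim (B ⧸ p ⊔ Ideal.span {x}) + 1 = ringKrullDim (B ⧸ p) := by
  have hlocal : IsLocalRing (B ⧸ p) :=
    IsLocalRing.of_surjective' (Ideal.Quotient.mk p) Ideal.Quotient.mk_surjective
  rw [← ringKrullDim_eq_of_ringEquiv (DoubleQuot.quotQuotEquivQuotSup p (Ideal.span {x})),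
    Ideal.map_span, Set.image_singleton]
  refine ringKrullDim_quotient_span_singleton_succ_eq_ringKrullDim_of_mem_nonZeroDivisors
    (mem_nonZeroDivisors_of_ne_zero ?_) ?_
  · rwa [Ne, Ideal.Quotient.eq_zero_iff_mem]
  · have := IsLocalHom.of_surjective (Ideal.Quotient.mk p) Ideal.Quotient.mk_surjective
    exact map_nonunit (Ideal.Quotient.mk p) x hx

theorem span_image_mem_minimalPrimes {V B : Type*} {G : SimpleGraph V} [CommRing B] {x : V → B}
    (hz : ∀ u v, G.Adj u v → x u * x v = 0)
    (hprime : ∀ C, IsVertexCover G C → (Ideal.span (x '' C)).IsPrime)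
    (hnot : ∀ C, IsVertexCover G C → ∀ v ∉ C, x v ∉ Ideal.span (x '' C))
    {C : Set V} (hC : IsMinVertexCover G C) :
    Ideal.span (x '' C) ∈ (⊥ : Ideal B).minimalPrimes := by
  refine ⟨⟨hprime C hC.1, bot_le⟩, fun q hq hqC => ?_⟩
  have hcover : IsVertexCover G {v | x v ∈ q} := fun u v huv =>
    hq.1.mem_or_mem (hz u v huv ▸ q.zero_mem)
  have hsub : {v | x v ∈ q} ⊆ C := fun v hv => by
    by_contra hvC
    exact hnot C hC.1 v hvC (hqC hv)
  rw [Ideal.span_le, Set.image_subset_iff]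
  exact (hC.2 _ hsub hcover).ge

section LocalRing

variable {V : Type*} [Finite V] {G : SimpleGraph V} {B : Type u} [CommRing B] [IsLocalRing B]
  [IsNoetherianRing B] {x : V → B}

theorem ringKrullDim_quotient_span_image
    (hprime : ∀ C, IsVertexCover G C → (Ideal.span (x '' C)).IsPrime)
    (hnot : ∀ C, IsVertexCover G C → ∀ v ∉ C, x v ∉ Ideal.span (x '' C))
    (hmax : Ideal.span (x '' Set.univ) = maximalIdeal B) {C : Set V} (hC : IsVertexCover G C) :
    ringKrullDim (B ⧸ Ideal.span (x '' C)) = (Cᶜ.ncard : ℕ) := by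
  induction hn : Cᶜ.ncard generalizing C with
  | zero =>
    rw [Set.ncard_eq_zero, Set.compl_empty_iff] at hn
    subst hn
    rw [hmax]
    exact ringKrullDim_eq_zero_of_field (ResidueField B)
  | succ n ih =>
    obtain ⟨v, hv⟩ : Cᶜ.Nonempty := by
      rw [← Set.ncard_pos, hn]
      exact n.succ_pos
    have hcover : IsVertexCover G (insert v C) := fun a b hab =>
      (hC hab).imp (Set.mem_insert_of_mem v) (Set.mem_insert_of_mem v)
    have hcard : (insert v C)ᶜ.ncard = n := by
      have h1 : (insert v C)ᶜ = Cᶜ \ {v} := by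
        rw [← Set.union_singleton, Set.compl_union, Set.sdiff_eq]
      rw [h1, Set.ncard_sdiff_singleton_of_mem hv, hn, Nat.add_sub_cancel]
    have := hprime C hC
    rw [← ringKrullDim_quotient_sup_span_singleton_add_one (Ideal.span (x '' C)) (x := x v)
      (hmax ▸ Ideal.subset_span ⟨v, Set.mem_univ v, rfl⟩) (hnot C hC v hv), ← Ideal.span_union,
      Set.union_singleton, ← Set.image_insert_eq, ih hcover hcard, Nat.cast_succ]

theorem isUnmixedGraph_of_localRingDepth_eq
    (hz : ∀ u v, G.Adj u v → x u * x v = 0)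
    (hprime : ∀ C, IsVertexCover G C → (Ideal.span (x '' C)).IsPrime)
    (hnot : ∀ C, IsVertexCover G C → ∀ v ∉ C, x v ∉ Ideal.span (x '' C))
    (hmax : Ideal.span (x '' Set.univ) = maximalIdeal B)
    (hCM : (localRingDepth B : WithBot ℕ∞) = ringKrullDim B) : IsUnmixedGraph G := by
  have hdim : ∀ C, IsMinVertexCover G C → ringKrullDim B = (Cᶜ.ncard : ℕ) := by
    intro C hC
    rw [← ringKrullDim_quotient_span_image hprime hnot hmax hC.1]
    refine le_antisymm (hCM ▸ localRingDepth_le_ringKrullDim_quotient ?_)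
      (ringKrullDim_quotient_le _)
    apply Module.associatedPrimes.minimalPrimes_annihilator_subset_associatedPrimes
    rw [Module.annihilator_eq_bot.2 inferInstance]
    exact span_image_mem_minimalPrimes hz hprime hnot hC
  intro C₁ C₂ h₁ h₂
  have hcard : C₁ᶜ.ncard = C₂ᶜ.ncard := by exact_mod_cast (hdim C₁ h₁).symm.trans (hdim C₂ h₂)
  have := Set.ncard_add_ncard_compl C₁
  have := Set.ncard_add_ncard_compl C₂
  lia

end LocalRing

section EdgeIdeal

variable {K V : Type*} [Field K]

theorem span_X_image_eq_ker {L : Type*} [CommRing L] [Algebra K L] {C : Set V}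
    (φ : MvPolynomial V K →ₐ[K] L) (s : L →ₐ[K] MvPolynomial V K)
    (hφ : ∀ v ∈ C, φ (MvPolynomial.X v) = 0)
    (hs : ∀ v ∉ C, s (φ (MvPolynomial.X v)) = MvPolynomial.X v) :
    Ideal.span (MvPolynomial.X '' C) = RingHom.ker φ := by
  refine le_antisymm (Ideal.span_le.2 ?_) fun p hp => ?_
  · rintro _ ⟨v, hv, rfl⟩
    exact hφ v hv
  · have hcomp : (Ideal.Quotient.mkₐ K (Ideal.span (MvPolynomial.X '' C))).comp (s.comp φ) =
        Ideal.Quotient.mkₐ K (Ideal.span (MvPolynomial.X '' C)) := by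
      refine MvPolynomial.algHom_ext fun v => ?_
      by_cases hv : v ∈ C
      · rw [AlgHom.comp_apply, AlgHom.comp_apply, hφ v hv, map_zero, map_zero]
        exact (Ideal.Quotient.eq_zero_iff_mem.2
          (Ideal.subset_span (Set.mem_image_of_mem _ hv))).symm
      · rw [AlgHom.comp_apply, AlgHom.comp_apply, hs v hv]
    rw [← Ideal.Quotient.eq_zero_iff_mem, ← Ideal.Quotient.mkₐ_eq_mk K, ← hcomp,
      AlgHom.comp_apply, AlgHom.comp_apply, (RingHom.mem_ker).1 hp, map_zero, map_zero]

open Classical in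
theorem isPrime_span_X_image (C : Set V) :
    (Ideal.span (MvPolynomial.X '' C) : Ideal (MvPolynomial V K)).IsPrime := by
  rw [span_X_image_eq_ker (K := K) (C := C)
    (MvPolynomial.aeval fun v => if v ∈ C then 0 else MvPolynomial.X v) (AlgHom.id K _)
    (fun v hv => by simp [hv]) (fun v hv => by simp [hv])]
  exact RingHom.ker_isPrime _

theorem isMaximal_span_X_image_univ :
    (Ideal.span (MvPolynomial.X '' Set.univ) : Ideal (MvPolynomial V K)).IsMaximal := by
  rw [span_X_image_eq_ker (K := K) (C := Set.univ)
    (MvPolynomial.aeval fun _ => (0 : K)) (Algebra.ofId K _)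
    (fun v _ => by simp) (fun v hv => absurd (Set.mem_univ v) hv)]
  exact RingHom.ker_isMaximal_of_surjective _ fun a => ⟨MvPolynomial.C a, by simp⟩

theorem X_notMem_span_X_image {C : Set V} {v : V} (hv : v ∉ C) :
    (MvPolynomial.X v : MvPolynomial V K) ∉ Ideal.span (MvPolynomial.X '' C) := by
  rw [MvPolynomial.mem_ideal_span_X_image]
  intro hmem
  obtain ⟨i, hi, hne⟩ := hmem (Finsupp.single v 1) (by simp)
  exact hne (Finsupp.single_eq_of_ne fun h => hv (h ▸ hi))

theorem edgeIdeal_le_span_X_image {G : SimpleGraph V} {C : Set V} (hC : IsVertexCover G C) :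
    edgeIdeal K G ≤ Ideal.span (MvPolynomial.X '' C) := by
  rw [edgeIdeal_le_iff]
  intro u v huv
  rcases hC huv with h | h
  · exact Ideal.mul_mem_right _ _ (Ideal.subset_span ⟨u, h, rfl⟩)
  · exact Ideal.mul_mem_left _ _ (Ideal.subset_span ⟨v, h, rfl⟩)

end EdgeIdeal

theorem isUnmixedGraph_of_isCohenMacaulayRing {V : Type} [Finite V] (K : Type u) [Field K]
    {G : SimpleGraph V} (hCM : IsCohenMacaulayRing (MvPolynomial V K ⧸ edgeIdeal K G)) :
    IsUnmixedGraph G := by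
  let π := Ideal.Quotient.mk (edgeIdeal K G)
  let J : Set V → Ideal (MvPolynomial V K) := fun C => Ideal.span (MvPolynomial.X '' C)
  have hπ : Function.Surjective π := Ideal.Quotient.mk_surjective
  have hcomap : ∀ C, IsVertexCover G C → ((J C).map π).comap π = J C := fun C hC => by
    rw [Ideal.comap_map_of_surjective π hπ, ← RingHom.ker_eq_comap_bot, Ideal.mk_ker,
      sup_eq_left]
    exact edgeIdeal_le_span_X_image hC
  have hprime : ∀ C, IsVertexCover G C → ((J C).map π).IsPrime := fun C hC => by
    have := isPrime_span_X_image (K := K) C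
    refine Ideal.map_isPrime_of_surjective hπ ?_
    rw [Ideal.mk_ker]
    exact edgeIdeal_le_span_X_image hC
  have huniv : IsVertexCover G Set.univ := fun u _ _ => Or.inl (Set.mem_univ u)
  have hle : ∀ C, (J C).map π ≤ (J Set.univ).map π := fun C =>
    Ideal.map_mono (Ideal.span_mono (Set.image_mono (Set.subset_univ C)))
  have hmax : ((J Set.univ).map π).IsMaximal := by
    have := isMaximal_span_X_image_univ (K := K) (V := V)
    refine (Ideal.map_eq_top_or_isMaximal_of_surjective π hπ this).resolve_left ?_
    exact (hprime _ huniv).ne_top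
  let P := (J Set.univ).map π
  let ι := algebraMap (MvPolynomial V K ⧸ edgeIdeal K G) (Localization.AtPrime P)
  have hspan : ∀ C, Ideal.span ((fun v => ι (π (MvPolynomial.X v))) '' C) =
      ((J C).map π).map ι := fun C => by
    rw [Ideal.map_span, Ideal.map_span, Set.image_image, Set.image_image]
  refine isUnmixedGraph_of_localRingDepth_eq (x := fun v => ι (π (MvPolynomial.X v)))
    (fun u v huv => ?_) (fun C hC => ?_) (fun C hC v hv hmem => ?_) ?_ (hCM P)
  · rw [← map_mul, mk_X_mul_mk_X_eq_zero K huv, map_zero]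
  · have := hprime C hC
    rw [hspan]
    exact Ideal.isPrime_map_of_isLocalizationAtPrime P (hle C)
  · have := hprime C hC
    rw [hspan, ← Ideal.mem_comap] at hmem
    have hunder : (((J C).map π).map ι).comap ι = (J C).map π :=
      Ideal.under_map_of_isLocalizationAtPrime P (hle C)
    rw [hunder, ← Ideal.mem_comap, hcomap C hC] at hmem
    exact X_notMem_span_X_image hv hmem
  · rw [hspan]
    exact Localization.AtPrime.map_eq_maximalIdeal

end Unmixed

/-- For a graph `G` with `2h` non-isolated vertices labeled so that conditions (*) and (**)
hold, the following are equivalent: (1) `G` is Cohen-Macaulay; (2) `G` is unmixed;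
(3) both: (i) `z_i x_j, y_j x_k ∈ E(G)` implies `z_i x_k ∈ E(G)` for distinct `i, j, k` and
`z_i ∈ {x_i, y_i}`, and (ii) `x_i y_j ∈ E(G)` implies `x_i x_j ∉ E(G)`. -/
theorem CM_iff_unmixed_iff_conditions {h : ℕ} (K : Type u) [Field K]
    (G : SimpleGraph (Fin h ⊕ Fin h)) (hiso : HasNoIsolatedVertices G)
    (hstar : CondStar G)
    (hstarstar : ∀ i j : Fin h, G.Adj (Sum.inl i) (Sum.inr j) → i ≤ j) :
    (IsCohenMacaulayRing (MvPolynomial (Fin h ⊕ Fin h) K ⧸ edgeIdeal K G) ↔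
        IsUnmixedGraph G) ∧
      (IsUnmixedGraph G ↔
        ((∀ i j k : Fin h, i ≠ j → j ≠ k → i ≠ k → ∀ z : Fin h ⊕ Fin h,
            (z = Sum.inl i ∨ z = Sum.inr i) →
            G.Adj z (Sum.inl j) → G.Adj (Sum.inr j) (Sum.inl k) → G.Adj z (Sum.inl k)) ∧
          (∀ i j : Fin h, G.Adj (Sum.inl i) (Sum.inr j) →
            ¬ G.Adj (Sum.inl i) (Sum.inl j)))) := by
  have hcond := isUnmixedGraph_iff_conditions hstar
  refine ⟨⟨fun hCM => isUnmixedGraph_of_isCohenMacaulayRing K hCM, fun hu => ?_⟩, hcond⟩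
  obtain ⟨h1, h2⟩ := hcond.1 hu
  exact isCohenMacaulayRing_of_conditions K hstar.2.2 hstarstar
    (fun i j hij => hstar.2.1.1 ⟨i, rfl⟩ ⟨j, rfl⟩ hij.ne hij) h1 h2
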